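/- Let Δ be a closed convex subset of a CAT(κ) space X̂ and let π : Ŷ → X̂ be a simple branched cover of X̂ over Δ; if κ > 0, assume additionally Diam(X̂) < π/(2√κ) and Diam(Ŷ) < 2π/(3√κ). If x ∈ Y = Ŷ − Δ, then the set of points of Ŷ that can be joined with x by a geodesic of Ŷ whose image misses Δ is an open subset of Ŷ. (Lemma 3.2(v)) -/

import Mathlib

open Set Metric
open scoped ENNReal

noncomputable section

/-- A path in a metric space: a continuous map defined on a compact interval `[a, b]`
(with `a ≤ b`). -/
structure MPath (X : Type*) [MetricSpace X] where
  a : ℝ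
  b : ℝ
  hab : a ≤ b
  toFun : ℝ → X
  cont : ContinuousOn toFun (Set.Icc a b)

namespace MPath

variable {X : Type*} [MetricSpace X]

/-- The length of a path: the total variation of the map on `[a, b]`. -/
def length (γ : MPath X) : ℝ≥0∞ := eVariationOn γ.toFun (Set.Icc γ.a γ.b)

/-- The initial endpoint of a path. -/
def initial (γ : MPath X) : X := γ.toFun γ.a

/-- The final endpoint of a path. -/
def final (γ : MPath X) : X := γ.toFun γ.b

end MPath

/-- A geodesic in a metric space: a map on `[a, b]` with `dist (γ s) (γ t) = |s - t|`.
(Such a map is automatically a continuous path.) -/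
structure GeodesicIn (X : Type*) [MetricSpace X] where
  a : ℝ
  b : ℝ
  hab : a ≤ b
  toFun : ℝ → X
  isom : ∀ s ∈ Set.Icc a b, ∀ t ∈ Set.Icc a b, dist (toFun s) (toFun t) = |s - t|

namespace GeodesicIn

variable {X : Type*} [MetricSpace X]

/-- The initial endpoint of a geodesic. -/
def initial (γ : GeodesicIn X) : X := γ.toFun γ.a

/-- The final endpoint of a geodesic. -/
def final (γ : GeodesicIn X) : X := γ.toFun γ.b

/-- The length of a geodesic. -/
def length (γ : GeodesicIn X) : ℝ := γ.b - γ.a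

end GeodesicIn

/-- A metric space is geodesic if any two points are joined by a geodesic. -/
def IsGeodesicSpace (X : Type*) [MetricSpace X] : Prop :=
  ∀ x y : X, ∃ γ : GeodesicIn X, γ.initial = x ∧ γ.final = y

/-- Inverse hyperbolic cosine. -/
def arcoshReal (x : ℝ) : ℝ := Real.log (x + Real.sqrt (x ^ 2 - 1))

/-- The angle at a vertex of a triangle in the model space `M_κ²` whose two adjacent sides
have lengths `a`, `b` and whose opposite side has length `c`, computed by the appropriate
(euclidean, hyperbolic or spherical) law of cosines. -/
def modelAngle (κ a b c : ℝ) : ℝ :=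
  if κ = 0 then Real.arccos ((a ^ 2 + b ^ 2 - c ^ 2) / (2 * a * b))
  else if κ < 0 then
    Real.arccos
      ((Real.cosh (Real.sqrt (-κ) * a) * Real.cosh (Real.sqrt (-κ) * b) -
          Real.cosh (Real.sqrt (-κ) * c)) /
        (Real.sinh (Real.sqrt (-κ) * a) * Real.sinh (Real.sqrt (-κ) * b)))
  else
    Real.arccos
      ((Real.cos (Real.sqrt κ * c) - Real.cos (Real.sqrt κ * a) * Real.cos (Real.sqrt κ * b)) /
        (Real.sin (Real.sqrt κ * a) * Real.sin (Real.sqrt κ * b)))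

/-- The distance in the model space `M_κ²` between two points lying at distances `s` and `t`
from a common vertex, along two geodesics making an angle `θ` at that vertex, computed by the
appropriate law of cosines. -/
def modelDistFromVertex (κ s t θ : ℝ) : ℝ :=
  if κ = 0 then Real.sqrt (s ^ 2 + t ^ 2 - 2 * s * t * Real.cos θ)
  else if κ < 0 then
    (1 / Real.sqrt (-κ)) *
      arcoshReal (Real.cosh (Real.sqrt (-κ) * s) * Real.cosh (Real.sqrt (-κ) * t) -
        Real.sinh (Real.sqrt (-κ) * s) * Real.sinh (Real.sqrt (-κ) * t) * Real.cos θ)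
  else
    (1 / Real.sqrt κ) *
      Real.arccos (Real.cos (Real.sqrt κ * s) * Real.cos (Real.sqrt κ * t) +
        Real.sin (Real.sqrt κ * s) * Real.sin (Real.sqrt κ * t) * Real.cos θ)

/-- A (geodesic) triangle in a metric space: three geodesics, the final endpoint of each being
the initial endpoint of the next (indices mod 3). -/
structure TriangleIn (X : Type*) [MetricSpace X] where
  edge : Fin 3 → GeodesicIn X
  compat : ∀ i : Fin 3, (edge i).final = (edge (i + 1)).initial

namespace TriangleIn

variable {X : Type*} [MetricSpace X]

/-- The perimeter of a triangle. -/
def perimeter (T : TriangleIn X) : ℝ := ∑ i, (T.edge i).length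

/-- The distance, in a comparison triangle for `T` in the model space `M_κ²`, between the
points corresponding to the point of parameter `s` on edge `i` and the point of parameter `t`
on edge `j`.  (Any two edges of a triangle share a vertex, and the comparison distance is
computed via the model-space law of cosines at the corresponding shared vertex.) -/
def cmpDist (κ : ℝ) (T : TriangleIn X) (i j : Fin 3) (s t : ℝ) : ℝ :=
  if i = j then |s - t|
  else if j = i + 1 then
    modelDistFromVertex κ ((T.edge i).b - s) (t - (T.edge j).a)
      (modelAngle κ (T.edge i).length (T.edge j).length (T.edge (i + 2)).length)
  else
    modelDistFromVertex κ (s - (T.edge i).a) ((T.edge j).b - t)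
      (modelAngle κ (T.edge i).length (T.edge j).length (T.edge (i + 1)).length)

/-- A triangle satisfies CAT(κ) if its perimeter is `< 2π/√κ` (no condition when `κ ≤ 0`)
and each distance between points on two of its edges is at most the distance between the
corresponding points of a comparison triangle in `M_κ²`. -/
def SatisfiesCAT (κ : ℝ) (T : TriangleIn X) : Prop :=
  (0 < κ → T.perimeter < 2 * Real.pi / Real.sqrt κ) ∧
    ∀ i j : Fin 3, ∀ s ∈ Set.Icc (T.edge i).a (T.edge i).b,
      ∀ t ∈ Set.Icc (T.edge j).a (T.edge j).b,
        dist ((T.edge i).toFun s) ((T.edge j).toFun t) ≤ T.cmpDist κ i j s t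

end TriangleIn

/-- A metric space is CAT(κ) if it is geodesic and every triangle of perimeter `< 2π/√κ`
(every triangle, when `κ ≤ 0`) satisfies the CAT(κ) comparison inequality. -/
def IsCATSpace (κ : ℝ) (X : Type*) [MetricSpace X] : Prop :=
  IsGeodesicSpace X ∧
    ∀ T : TriangleIn X, (0 < κ → T.perimeter < 2 * Real.pi / Real.sqrt κ) → T.SatisfiesCAT κ

/-- `A` is a convex subset of the subspace `V`: any two points of `A` are joined by a geodesic
lying in `V`, and every geodesic lying in `V` joining two points of `A` lies in `A`. -/
def IsConvexIn {X : Type*} [MetricSpace X] (V A : Set X) : Prop :=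
  ∀ x ∈ A, ∀ y ∈ A,
    (∃ γ : GeodesicIn X, γ.initial = x ∧ γ.final = y ∧ ∀ t ∈ Set.Icc γ.a γ.b, γ.toFun t ∈ V) ∧
      ∀ γ : GeodesicIn X, γ.initial = x → γ.final = y →
        (∀ t ∈ Set.Icc γ.a γ.b, γ.toFun t ∈ V) → ∀ t ∈ Set.Icc γ.a γ.b, γ.toFun t ∈ A

/-- A convex subset of a metric space: any two of its points are joined by a geodesic of the
ambient space, and every such geodesic lies in the subset. -/
def IsConvexSubset {X : Type*} [MetricSpace X] (A : Set X) : Prop :=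
  IsConvexIn Set.univ A

/-- A metric space has curvature `≤ κ` (is locally CAT(κ)) if each point has a convex CAT(κ)
neighborhood. -/
def HasCurvatureLE (κ : ℝ) (X : Type*) [MetricSpace X] : Prop :=
  ∀ x : X, ∃ V : Set X, V ∈ nhds x ∧ IsConvexSubset V ∧ IsCATSpace κ ↥V

/-- A metric space is a length space if any two points are joined by paths of length
arbitrarily close to the distance between them. -/
def IsLengthSpace (X : Type*) [MetricSpace X] : Prop :=
  ∀ x y : X, ∀ ε : ℝ, 0 < ε →
    ∃ γ : MPath X, γ.initial = x ∧ γ.final = y ∧ γ.length < ENNReal.ofReal (dist x y + ε)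

/-- The induced path (pseudo)distance on the subset `S`: the infimum of the lengths of paths
joining `x` and `y` inside `S`. -/
def pathDistIn {X : Type*} [MetricSpace X] (S : Set X) (x y : X) : ℝ≥0∞ :=
  ⨅ (γ : MPath X) (_ : γ.initial = x) (_ : γ.final = y)
    (_ : ∀ t ∈ Set.Icc γ.a γ.b, γ.toFun t ∈ S), γ.length

/-- `π : Y → X` is a simple branched cover of `X` over `Δ ⊆ X`: `X` and `Y` are length
spaces, the restriction of `π` over the complement of `Δ` is a locally isometric covering
map onto `X − Δ`, and `π` preserves distances from points of `π⁻¹(Δ)`. -/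
structure IsSimpleBranchedCover {Y X : Type*} [MetricSpace Y] [MetricSpace X]
    (π : Y → X) (Δ : Set X) : Prop where
  base_lengthSpace : IsLengthSpace X
  total_lengthSpace : IsLengthSpace Y
  covering : IsCoveringMap fun y : {y : Y // π y ∉ Δ} => (⟨π y.1, y.2⟩ : {x : X // x ∉ Δ})
  covering_surj :
    Function.Surjective fun y : {y : Y // π y ∉ Δ} => (⟨π y.1, y.2⟩ : {x : X // x ∉ Δ})
  locally_isometric : ∀ y : Y, π y ∉ Δ → ∃ ε > 0, ∀ u v : Y, π u ∉ Δ → π v ∉ Δ →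
    dist u y < ε → dist v y < ε → dist (π u) (π v) = dist u v
  dist_eq : ∀ y z : Y, π y ∈ Δ ∨ π z ∈ Δ → dist y z = dist (π y) (π z)

/-- The restriction of a map `π : Y → X` to a subset `V ⊆ Y`, viewed as a map onto its
image. -/
def restrictToImage {Y X : Type*} (π : Y → X) (V : Set Y) : ↥V → ↥(π '' V) :=
  fun v => ⟨π v.1, ⟨v.1, v.2, rfl⟩⟩

end

open Filter Topology

/-- Chaining along an interval: a transitive relation that holds between every point and all
nearby points holds between the endpoints. -/
theorem rel_Icc_of_local {R : ℝ → ℝ → Prop} {a b : ℝ} (hab : a ≤ b)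
    (htrans : ∀ s t u, s ≤ t → t ≤ u → R s t → R t u → R s u)
    (hloc : ∀ t ∈ Icc a b, ∃ ε > 0, ∀ s ∈ Icc a b, |s - t| < ε →
      (s ≤ t → R s t) ∧ (t ≤ s → R t s)) : R a b := by
  set S : Set ℝ := {t | t ∈ Icc a b ∧ R a t} with hS
  have haS : a ∈ S := by
    obtain ⟨ε, hε, h⟩ := hloc a ⟨le_rfl, hab⟩
    exact ⟨⟨le_rfl, hab⟩, (h a ⟨le_rfl, hab⟩ (by simpa using hε)).1 le_rfl⟩
  have hbdd : BddAbove S := ⟨b, fun t ht => ht.1.2⟩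
  have hac : a ≤ sSup S := le_csSup hbdd haS
  have hcb : sSup S ≤ b := csSup_le ⟨a, haS⟩ fun t ht => ht.1.2
  obtain ⟨ε, hε, h⟩ := hloc (sSup S) ⟨hac, hcb⟩
  obtain ⟨s, hsS, hs⟩ := exists_lt_of_lt_csSup ⟨a, haS⟩ (sub_lt_self (sSup S) hε)
  have hsc : s ≤ sSup S := le_csSup hbdd hsS
  have hRc : R a (sSup S) := htrans a s _ hsS.1.1 hsc hsS.2
    ((h s hsS.1 (abs_lt.2 ⟨by linarith, by linarith⟩)).1 hsc)
  rcases hcb.eq_or_lt with hc | hc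
  · rwa [hc] at hRc
  · exfalso
    have hlt : sSup S < min b (sSup S + ε / 2) := lt_min hc (by linarith)
    have hle : min b (sSup S + ε / 2) ≤ sSup S + ε / 2 := min_le_right _ _
    have hmem : min b (sSup S + ε / 2) ∈ Icc a b := ⟨hac.trans hlt.le, min_le_left _ _⟩
    have hR := (h _ hmem (abs_lt.2 ⟨by linarith, by linarith⟩)).2 hlt.le
    exact absurd (le_csSup hbdd ⟨hmem, htrans a _ _ hac hlt.le hRc hR⟩) (not_le.2 hlt)

/-- A map that near each point does not increase the distance to that point does not increase
the length of paths. -/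
theorem edist_comp_le_eVariationOn {X Y : Type*} [MetricSpace X] [MetricSpace Y] {f : Y → X}
    (hf : ∀ y, ∃ ε > 0, ∀ z, dist z y < ε → dist (f z) (f y) ≤ dist z y)
    {σ : ℝ → Y} {a b : ℝ} (hab : a ≤ b) (hσ : ContinuousOn σ (Icc a b)) :
    edist (f (σ a)) (f (σ b)) ≤ eVariationOn σ (Icc a b) := by
  refine rel_Icc_of_local (R := fun s t => edist (f (σ s)) (f (σ t)) ≤ eVariationOn σ (Icc s t))
    hab ?_ ?_
  · intro s t u hst htu h₁ h₂
    have h := eVariationOn.Icc_add_Icc σ (s := univ) hst htu (mem_univ t)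
    simp only [univ_inter] at h
    rw [← h]
    exact (edist_triangle _ _ _).trans (add_le_add h₁ h₂)
  · intro t ht
    obtain ⟨ε, hε, h⟩ := hf (σ t)
    obtain ⟨δ, hδ, hδ'⟩ := Metric.continuousOn_iff.1 hσ t ht ε hε
    refine ⟨δ, hδ, fun s hs hst => ?_⟩
    have key : edist (f (σ s)) (f (σ t)) ≤ edist (σ s) (σ t) := by
      rw [edist_dist, edist_dist]
      exact ENNReal.ofReal_le_ofReal (h _ (hδ' s hs hst))
    refine ⟨fun hle => key.trans (eVariationOn.edist_le σ ⟨le_rfl, hle⟩ ⟨hle, le_rfl⟩),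
      fun hle => ?_⟩
    rw [edist_comm]
    exact key.trans (eVariationOn.edist_le σ ⟨hle, le_rfl⟩ ⟨le_rfl, hle⟩)

/-- A map on a length space that near each point does not increase the distance to that point
is `1`-Lipschitz. -/
theorem IsLengthSpace.dist_map_le {X Y : Type*} [MetricSpace X] [MetricSpace Y]
    (hY : IsLengthSpace Y) {f : Y → X}
    (hf : ∀ y, ∃ ε > 0, ∀ z, dist z y < ε → dist (f z) (f y) ≤ dist z y) (y z : Y) :
    dist (f y) (f z) ≤ dist y z := by
  refine le_of_forall_pos_le_add fun ε hε => ?_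
  obtain ⟨γ, h₁, h₂, h⟩ := hY y z ε hε
  have hlt := (edist_comp_le_eVariationOn hf γ.hab γ.cont).trans_lt h
  have e₁ : γ.toFun γ.a = y := h₁
  have e₂ : γ.toFun γ.b = z := h₂
  rw [e₁, e₂, edist_dist] at hlt
  exact (ENNReal.ofReal_le_ofReal_iff (by positivity)).1 hlt.le

/-- `π` restricts to an isometry of the ball of radius `r` about `y` onto the ball of radius `r`
about `π y`, and the former ball misses the preimage of `Δ`. -/
structure IsIsometricBall {X Y : Type*} [MetricSpace X] [MetricSpace Y] (π : Y → X) (Δ : Set X)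
    (y : Y) (r : ℝ) : Prop where
  notMem : ∀ v, dist v y < r → π v ∉ Δ
  dist_eq : ∀ u v, dist u y < r → dist v y < r → dist (π u) (π v) = dist u v
  surj : ∀ p, dist p (π y) < r → ∃ v, dist v y < r ∧ π v = p

section BranchedCover

variable {X Y : Type*} [MetricSpace X] [MetricSpace Y] {π : Y → X} {Δ : Set X}

theorem IsIsometricBall.of_dist_add_le {y y' : Y} {r r' : ℝ} (h : IsIsometricBall π Δ y r)
    (hr : dist y' y + r' ≤ r) (hr' : 0 < r') : IsIsometricBall π Δ y' r' := by
  have hsub : ∀ v, dist v y' < r' → dist v y < r := fun v hv => by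
    linarith [dist_triangle v y' y]
  have hy' : dist y' y < r := by linarith
  have hr0 : 0 < r := dist_nonneg.trans_lt hy'
  refine ⟨fun v hv => h.notMem v (hsub v hv),
    fun u v hu hv => h.dist_eq u v (hsub u hu) (hsub v hv), fun p hp => ?_⟩
  have e := h.dist_eq y' y hy' (by simpa using hr0)
  obtain ⟨v, hv, rfl⟩ := h.surj p (by linarith [dist_triangle p (π y') (π y)])
  exact ⟨v, by rwa [← h.dist_eq v y' hv hy'], rfl⟩

theorem IsSimpleBranchedCover.isOpen_compl_preimage (hπ : IsSimpleBranchedCover π Δ)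
    (hΔ : IsClosed Δ) : IsOpen {y | π y ∉ Δ} := by
  rw [Metric.isOpen_iff]
  intro y hy
  obtain ⟨ε, hε, h⟩ := Metric.isOpen_iff.1 hΔ.isOpen_compl (π y) hy
  refine ⟨ε, hε, fun z hz hzΔ => h (?_ : π z ∈ ball (π y) ε) hzΔ⟩
  rw [mem_ball] at hz ⊢
  rwa [← hπ.dist_eq z y (Or.inl hzΔ)]

theorem IsSimpleBranchedCover.exists_isIsometricBall (hπ : IsSimpleBranchedCover π Δ)
    (hΔ : IsClosed Δ) {y : Y} (hy : π y ∉ Δ) : ∃ r > 0, IsIsometricBall π Δ y r := by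
  obtain ⟨ε₁, hε₁, h₁⟩ := Metric.isOpen_iff.1 (hπ.isOpen_compl_preimage hΔ) y hy
  obtain ⟨ε₂, hε₂, h₂⟩ := hπ.locally_isometric y hy
  set ε := min ε₁ ε₂
  have hε : 0 < ε := lt_min hε₁ hε₂
  have h₁' : ∀ v, dist v y < ε → π v ∉ Δ := fun v hv => h₁ (hv.trans_le (min_le_left _ _))
  have h₂' : ∀ u v, dist u y < ε → dist v y < ε → dist (π u) (π v) = dist u v := fun u v hu hv =>
    h₂ u v (h₁' u hu) (h₁' v hv) (hu.trans_le (min_le_right _ _)) (hv.trans_le (min_le_right _ _))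
  have hmem := hπ.covering.isOpenMap.image_mem_nhds
    (Metric.ball_mem_nhds (⟨y, hy⟩ : {y : Y // π y ∉ Δ}) hε)
  obtain ⟨δ₁, hδ₁, hsub⟩ := Metric.mem_nhds_iff.1 hmem
  obtain ⟨δ₂, hδ₂, hsub₂⟩ := Metric.isOpen_iff.1 hΔ.isOpen_compl (π y) hy
  set δ := min δ₁ δ₂
  have hδ : 0 < δ := lt_min hδ₁ hδ₂
  have hrε : min δ ε ≤ ε := min_le_right _ _
  refine ⟨min δ ε, lt_min hδ hε, fun v hv => h₁' v (hv.trans_le hrε),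
    fun u v hu hv => h₂' u v (hu.trans_le hrε) (hv.trans_le hrε), fun p hp => ?_⟩
  have hpδ : dist p (π y) < δ := hp.trans_le (min_le_left _ _)
  have hpΔ : p ∉ Δ := hsub₂ (hpδ.trans_le (min_le_right _ _))
  have hp₁ : (⟨p, hpΔ⟩ : {x : X // x ∉ Δ}) ∈ Metric.ball ⟨π y, hy⟩ δ₁ :=
    hpδ.trans_le (min_le_left _ _)
  obtain ⟨v, hv, hvp⟩ := hsub hp₁
  have hvp' : π v.1 = p := congrArg Subtype.val hvp
  have hvε : dist v.1 y < ε := hv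
  refine ⟨v.1, ?_, hvp'⟩
  rwa [← h₂' v.1 y hvε (by simpa using hε), hvp']

theorem IsSimpleBranchedCover.exists_isIsometricBall_of_isCompact
    (hπ : IsSimpleBranchedCover π Δ) (hΔ : IsClosed Δ) {K : Set Y} (hK : IsCompact K)
    (hKΔ : ∀ y ∈ K, π y ∉ Δ) : ∃ r > 0, ∀ y ∈ K, IsIsometricBall π Δ y r := by
  refine hK.induction_on (p := fun s => ∃ r > 0, ∀ y ∈ s, IsIsometricBall π Δ y r)
    ⟨1, one_pos, by simp⟩ ?_ ?_ ?_
  · rintro s t hst ⟨r, hr, h⟩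
    exact ⟨r, hr, fun y hy => h y (hst hy)⟩
  · rintro s t ⟨r, hr, h⟩ ⟨r', hr', h'⟩
    refine ⟨min r r', lt_min hr hr', ?_⟩
    rintro y (hy | hy)
    · exact (h y hy).of_dist_add_le (by simp) (lt_min hr hr')
    · exact (h' y hy).of_dist_add_le (by simp) (lt_min hr hr')
  · intro y hy
    obtain ⟨r, hr, h⟩ := hπ.exists_isIsometricBall hΔ (hKΔ y hy)
    refine ⟨ball y (r / 2), mem_nhdsWithin_of_mem_nhds (ball_mem_nhds y (half_pos hr)),
      r / 2, half_pos hr, fun y' hy' => h.of_dist_add_le ?_ (half_pos hr)⟩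
    have : dist y' y < r / 2 := hy'
    linarith

theorem IsSimpleBranchedCover.dist_map_le (hπ : IsSimpleBranchedCover π Δ) (hΔ : IsClosed Δ)
    (y z : Y) : dist (π y) (π z) ≤ dist y z := by
  refine hπ.total_lengthSpace.dist_map_le (fun y => ?_) y z
  by_cases hy : π y ∈ Δ
  · exact ⟨1, one_pos, fun z _ => (hπ.dist_eq z y (Or.inr hy)).ge⟩
  · obtain ⟨r, hr, h⟩ := hπ.exists_isIsometricBall hΔ hy
    exact ⟨r, hr, fun z hz => (h.dist_eq z y hz (by simpa using hr)).le⟩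

end BranchedCover

section ModelSpace

theorem arcoshReal_eq_arcosh : arcoshReal = Real.arcosh := rfl

/-- In the model space, two points at equal distance `s` from a vertex are at distance `2 * s`
only if the vertex is flat. -/
theorem add_le_of_two_mul_le_modelDistFromVertex {κ a b c s : ℝ} (hs : 0 < s) (hsa : s ≤ a)
    (hsb : s ≤ b) (hc : 0 ≤ c) (hκ : 0 < κ → a + b < Real.pi / Real.sqrt κ)
    (h : 2 * s ≤ modelDistFromVertex κ s s (modelAngle κ a b c)) : a + b ≤ c := by
  by_contra! hlt
  have ha : 0 < a := hs.trans_le hsa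
  have hb : 0 < b := hs.trans_le hsb
  have hcos : ∀ x, -1 < x → -1 < Real.cos (Real.arccos x) := by
    intro x hx
    rw [← Real.cos_pi]
    refine Real.cos_lt_cos_of_nonneg_of_le_pi (Real.arccos_nonneg x) le_rfl ?_
    exact lt_of_le_of_ne (Real.arccos_le_pi x) fun h => by
      rw [Real.arccos_eq_pi] at h; linarith
  refine absurd h (not_le.2 ?_)
  rcases lt_trichotomy κ 0 with hκ0 | hκ0 | hκ0
  · have hk : 0 < Real.sqrt (-κ) := Real.sqrt_pos.2 (by linarith)
    simp only [modelDistFromVertex, modelAngle, hκ0.ne, hκ0, if_true, if_false,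
      arcoshReal_eq_arcosh]
    set k := Real.sqrt (-κ)
    have hsa := Real.sinh_pos_iff.2 (mul_pos hk ha)
    have hsb := Real.sinh_pos_iff.2 (mul_pos hk hb)
    have hss := Real.sinh_pos_iff.2 (mul_pos hk hs)
    have hx := hcos ((Real.cosh (k * a) * Real.cosh (k * b) - Real.cosh (k * c)) /
        (Real.sinh (k * a) * Real.sinh (k * b))) (by
      rw [lt_div_iff₀ (by positivity)]
      have : Real.cosh (k * c) < Real.cosh (k * a + k * b) := by
        rw [Real.cosh_lt_cosh, abs_of_nonneg (by positivity), abs_of_nonneg (by positivity)]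
        nlinarith
      rw [Real.cosh_add] at this
      linarith)
    have hx' := Real.cos_le_one (Real.arccos ((Real.cosh (k * a) * Real.cosh (k * b) -
      Real.cosh (k * c)) / (Real.sinh (k * a) * Real.sinh (k * b))))
    set x := Real.cos (Real.arccos ((Real.cosh (k * a) * Real.cosh (k * b) -
      Real.cosh (k * c)) / (Real.sinh (k * a) * Real.sinh (k * b))))
    have hsq := Real.cosh_sq (k * s)
    have : Real.arcosh (Real.cosh (k * s) * Real.cosh (k * s) -
        Real.sinh (k * s) * Real.sinh (k * s) * x) < k * s + k * s := by
      rw [← Real.arcosh_cosh (x := k * s + k * s) (by positivity),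
        Real.arcosh_lt_arcosh _ (Real.cosh_pos _), Real.cosh_add]
      · nlinarith [mul_pos hss hss]
      · nlinarith [mul_pos hss hss]
    rw [one_div, inv_mul_lt_iff₀ hk]
    linarith
  · subst hκ0
    simp only [modelDistFromVertex, modelAngle, if_true]
    have hx := hcos ((a ^ 2 + b ^ 2 - c ^ 2) / (2 * a * b)) (by
      rw [lt_div_iff₀ (by positivity)]
      nlinarith)
    rw [Real.sqrt_lt' (by positivity)]
    nlinarith [mul_pos hs hs]
  · have hk : 0 < Real.sqrt κ := Real.sqrt_pos.2 hκ0
    simp only [modelDistFromVertex, modelAngle, hκ0.ne', hκ0.not_gt, if_false]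
    have hab := hκ hκ0
    set k := Real.sqrt κ
    rw [lt_div_iff₀ hk] at hab
    have hsin : ∀ t, 0 < t → t ≤ a + b → 0 < Real.sin (k * t) := fun t ht hta =>
      Real.sin_pos_of_pos_of_lt_pi (by positivity) (by nlinarith)
    have hsa' := hsin a ha (by linarith)
    have hsb' := hsin b hb (by linarith)
    have hss := hsin s hs (by linarith)
    have hx := hcos ((Real.cos (k * c) - Real.cos (k * a) * Real.cos (k * b)) /
        (Real.sin (k * a) * Real.sin (k * b))) (by
      rw [lt_div_iff₀ (by positivity)]
      have : Real.cos (k * a + k * b) < Real.cos (k * c) :=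
        Real.cos_lt_cos_of_nonneg_of_le_pi (by positivity) (by linarith) (by nlinarith)
      rw [Real.cos_add] at this
      linarith)
    set x := Real.cos (Real.arccos ((Real.cos (k * c) - Real.cos (k * a) * Real.cos (k * b)) /
        (Real.sin (k * a) * Real.sin (k * b))))
    have hx' : x ≤ 1 := Real.cos_le_one _
    have hsq := Real.sin_sq_add_cos_sq (k * s)
    have : Real.arccos (Real.cos (k * s) * Real.cos (k * s) +
        Real.sin (k * s) * Real.sin (k * s) * x) < k * s + k * s := by
      rw [← Real.arccos_cos (x := k * s + k * s) (by positivity) (by nlinarith)]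
      refine Real.arccos_lt_arccos (Real.neg_one_le_cos _) ?_ ?_
      · rw [Real.cos_add]
        nlinarith [mul_pos hss hss]
      · nlinarith [mul_pos hss hss]
    rw [one_div, inv_mul_lt_iff₀ hk]
    linarith

theorem modelAngle_self_zero {κ a : ℝ} (ha : 0 < a) (hκ : 0 < κ → a < Real.pi / Real.sqrt κ) :
    modelAngle κ a a 0 = 0 := by
  rcases lt_trichotomy κ 0 with hκ0 | hκ0 | hκ0
  · have hk : 0 < Real.sqrt (-κ) := Real.sqrt_pos.2 (by linarith)
    have hsa := Real.sinh_pos_iff.2 (mul_pos hk ha)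
    simp only [modelAngle, hκ0.ne, hκ0, if_true, if_false]
    rw [Real.arccos_eq_zero, le_div_iff₀ (by positivity)]
    have := Real.cosh_sq (Real.sqrt (-κ) * a)
    simp only [mul_zero, Real.cosh_zero]
    nlinarith
  · subst hκ0
    simp only [modelAngle, if_true]
    rw [Real.arccos_eq_zero, le_div_iff₀ (by positivity)]
    nlinarith
  · have hk : 0 < Real.sqrt κ := Real.sqrt_pos.2 hκ0
    have hab := hκ hκ0
    rw [lt_div_iff₀ hk] at hab
    have hsa : 0 < Real.sin (Real.sqrt κ * a) :=
      Real.sin_pos_of_pos_of_lt_pi (by positivity) (by linarith)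
    simp only [modelAngle, hκ0.ne', hκ0.not_gt, if_false]
    rw [Real.arccos_eq_zero, le_div_iff₀ (by positivity)]
    have := Real.sin_sq_add_cos_sq (Real.sqrt κ * a)
    simp only [mul_zero, Real.cos_zero]
    nlinarith

theorem tendsto_modelAngle_self_zero {α : Type*} {l : Filter α} {κ a : ℝ} {b c : α → ℝ}
    (ha : 0 < a) (hκ : 0 < κ → a < Real.pi / Real.sqrt κ) (hb : Tendsto b l (𝓝 a))
    (hc : Tendsto c l (𝓝 0)) : Tendsto (fun i => modelAngle κ a (b i) (c i)) l (𝓝 0) := by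
  suffices h : ContinuousAt (fun p : ℝ × ℝ => modelAngle κ a p.1 p.2) (a, 0) by
    have h' := h.tendsto.comp (hb.prodMk_nhds hc)
    simpa only [Function.comp_def, modelAngle_self_zero ha hκ] using h'
  rcases lt_trichotomy κ 0 with hκ0 | hκ0 | hκ0
  · have hk : 0 < Real.sqrt (-κ) := Real.sqrt_pos.2 (by linarith)
    have hsa := Real.sinh_pos_iff.2 (mul_pos hk ha)
    simp only [modelAngle, hκ0.ne, hκ0, if_true, if_false]
    refine Real.continuous_arccos.continuousAt.comp (ContinuousAt.div ?_ ?_ (by positivity))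
    · exact Continuous.continuousAt (by fun_prop)
    · exact Continuous.continuousAt (by fun_prop)
  · subst hκ0
    simp only [modelAngle, if_true]
    refine Real.continuous_arccos.continuousAt.comp (ContinuousAt.div ?_ ?_ (by positivity))
    · exact Continuous.continuousAt (by fun_prop)
    · exact Continuous.continuousAt (by fun_prop)
  · have hk : 0 < Real.sqrt κ := Real.sqrt_pos.2 hκ0
    have hab := hκ hκ0
    rw [lt_div_iff₀ hk] at hab
    have hsa : 0 < Real.sin (Real.sqrt κ * a) :=
      Real.sin_pos_of_pos_of_lt_pi (by positivity) (by linarith)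
    simp only [modelAngle, hκ0.ne', hκ0.not_gt, if_false]
    refine Real.continuous_arccos.continuousAt.comp (ContinuousAt.div ?_ ?_ (by positivity))
    · exact Continuous.continuousAt (by fun_prop)
    · exact Continuous.continuousAt (by fun_prop)

theorem tendsto_modelDistFromVertex_self_zero {α : Type*} {l : Filter α} (κ s : ℝ) {t θ : α → ℝ}
    (ht : Tendsto t l (𝓝 s)) (hθ : Tendsto θ l (𝓝 0)) :
    Tendsto (fun i => modelDistFromVertex κ (t i) (t i) (θ i)) l (𝓝 0) := by
  rcases lt_trichotomy κ 0 with hκ0 | hκ0 | hκ0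
  · simp only [modelDistFromVertex, hκ0.ne, hκ0, if_true, if_false]
    have harg : Tendsto (fun i => Real.cosh (Real.sqrt (-κ) * t i) * Real.cosh (Real.sqrt (-κ) * t i)
        - Real.sinh (Real.sqrt (-κ) * t i) * Real.sinh (Real.sqrt (-κ) * t i) * Real.cos (θ i))
        l (𝓝 1) := by
      have hc : Continuous fun p : ℝ × ℝ =>
          Real.cosh (Real.sqrt (-κ) * p.1) * Real.cosh (Real.sqrt (-κ) * p.1) -
          Real.sinh (Real.sqrt (-κ) * p.1) * Real.sinh (Real.sqrt (-κ) * p.1) * Real.cos p.2 := by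
        fun_prop
      have h := (hc.tendsto (s, 0)).comp (ht.prodMk_nhds hθ)
      have e : Real.cosh (Real.sqrt (-κ) * s) * Real.cosh (Real.sqrt (-κ) * s) -
          Real.sinh (Real.sqrt (-κ) * s) * Real.sinh (Real.sqrt (-κ) * s) * Real.cos 0 = 1 := by
        have := Real.cosh_sq (Real.sqrt (-κ) * s)
        rw [Real.cos_zero]
        nlinarith
      simpa only [Function.comp_def, e] using h
    have harc : ContinuousAt arcoshReal 1 := by
      unfold arcoshReal
      exact ContinuousAt.log (Continuous.continuousAt (by fun_prop)) (by simp)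
    have h := (harc.tendsto.comp harg).const_mul (1 / Real.sqrt (-κ))
    simpa [arcoshReal] using h
  · subst hκ0
    simp only [modelDistFromVertex, if_true]
    have hc : Continuous fun p : ℝ × ℝ =>
        Real.sqrt (p.1 ^ 2 + p.1 ^ 2 - 2 * p.1 * p.1 * Real.cos p.2) := by fun_prop
    have h := (hc.tendsto (s, 0)).comp (ht.prodMk_nhds hθ)
    have e : Real.sqrt (s ^ 2 + s ^ 2 - 2 * s * s * Real.cos 0) = 0 := by
      rw [Real.cos_zero, Real.sqrt_eq_zero']
      nlinarith
    simpa only [Function.comp_def, e] using h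
  · simp only [modelDistFromVertex, hκ0.ne', hκ0.not_gt, if_false]
    have hc : Continuous fun p : ℝ × ℝ => (1 / Real.sqrt κ) *
        Real.arccos (Real.cos (Real.sqrt κ * p.1) * Real.cos (Real.sqrt κ * p.1) +
          Real.sin (Real.sqrt κ * p.1) * Real.sin (Real.sqrt κ * p.1) * Real.cos p.2) :=
      continuous_const.mul (Real.continuous_arccos.comp (by fun_prop))
    have h := (hc.tendsto (s, 0)).comp (ht.prodMk_nhds hθ)
    have e : (1 / Real.sqrt κ) *
        Real.arccos (Real.cos (Real.sqrt κ * s) * Real.cos (Real.sqrt κ * s) +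
          Real.sin (Real.sqrt κ * s) * Real.sin (Real.sqrt κ * s) * Real.cos 0) = 0 := by
      have := Real.sin_sq_add_cos_sq (Real.sqrt κ * s)
      rw [Real.cos_zero, Real.arccos_eq_zero.2 (by nlinarith), mul_zero]
    simpa only [Function.comp_def, e] using h

end ModelSpace

section CATSpace

variable {X : Type*} [MetricSpace X] {κ : ℝ}

/-- The `CAT(κ)` comparison inequality for two geodesics issuing from a common point. -/
theorem IsCATSpace.dist_le_modelDistFromVertex (hX : IsCATSpace κ X) {c c' : ℝ → X} {L L' : ℝ}
    (hL : 0 ≤ L) (hL' : 0 ≤ L')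
    (hc : ∀ s ∈ Icc 0 L, ∀ t ∈ Icc 0 L, dist (c s) (c t) = |s - t|)
    (hc' : ∀ s ∈ Icc 0 L', ∀ t ∈ Icc 0 L', dist (c' s) (c' t) = |s - t|) (h0 : c 0 = c' 0)
    (hκ : 0 < κ → L + L' + dist (c L) (c' L') < 2 * Real.pi / Real.sqrt κ)
    {s t : ℝ} (hs : s ∈ Icc 0 L) (ht : t ∈ Icc 0 L') :
    dist (c s) (c' t) ≤ modelDistFromVertex κ s t (modelAngle κ L L' (dist (c L) (c' L'))) := by
  obtain ⟨g, hg₁, hg₂⟩ := hX.1 (c' L') (c L)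
  have hgl : g.length = dist (c L) (c' L') := by
    have h := g.isom g.a ⟨le_rfl, g.hab⟩ g.b ⟨g.hab, le_rfl⟩
    have e₁ : g.toFun g.a = c' L' := hg₁
    have e₂ : g.toFun g.b = c L := hg₂
    rw [e₁, e₂, abs_sub_comm, abs_of_nonneg (sub_nonneg.2 g.hab), dist_comm] at h
    exact h.symm
  let e₀ : GeodesicIn X :=
    { a := -L, b := 0, hab := by linarith, toFun := fun u => c (-u)
      isom := fun u hu v hv => by
        rw [hc (-u) ⟨by linarith [hu.2], by linarith [hu.1]⟩ (-v)
          ⟨by linarith [hv.2], by linarith [hv.1]⟩, abs_sub_comm]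
        congr 1; ring }
  let e₁ : GeodesicIn X := { a := 0, b := L', hab := hL', toFun := c', isom := hc' }
  let T : TriangleIn X :=
    { edge := ![e₀, e₁, g]
      compat := by
        intro i
        fin_cases i
        · show c (-0) = c' 0
          rw [neg_zero, h0]
        · exact hg₁.symm
        · show g.final = c (- -L)
          rw [neg_neg]; exact hg₂ }
  have hT₀ : T.edge 0 = e₀ := rfl
  have hT₁ : T.edge 1 = e₁ := rfl
  have hT₂ : T.edge 2 = g := rfl
  have hl₀ : e₀.length = L := by show 0 - -L = L; ring
  have hl₁ : e₁.length = L' := by show L' - 0 = L'; ring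
  have hper : T.perimeter = L + L' + dist (c L) (c' L') := by
    rw [TriangleIn.perimeter, Fin.sum_univ_three, hT₀, hT₁, hT₂, hl₀, hl₁, hgl]
  have h := (hX.2 T fun h => hper ▸ hκ h).2 0 1 (-s)
    ⟨by show -L ≤ -s; linarith [hs.2], by show -s ≤ 0; linarith [hs.1]⟩ t ht
  have hcmp : T.cmpDist κ 0 1 (-s) t =
      modelDistFromVertex κ (0 - -s) (t - 0) (modelAngle κ e₀.length e₁.length g.length) := rfl
  rw [hcmp, hl₀, hl₁, hgl, zero_sub, neg_neg, sub_zero] at h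
  have hd : dist ((T.edge 0).toFun (-s)) ((T.edge 1).toFun t) = dist (c s) (c' t) := by
    show dist (c (- -s)) (c' t) = _
    rw [neg_neg]
  rwa [hd] at h

/-- In a `CAT(κ)` space, a local geodesic of length less than `π / √κ` is a geodesic. -/
theorem IsCATSpace.dist_eq_of_local (hX : IsCATSpace κ X) {f : ℝ → X} {L r : ℝ} (hr : 0 < r)
    (hκ : 0 < κ → L < Real.pi / Real.sqrt κ)
    (hlip : ∀ s ∈ Icc 0 L, ∀ t ∈ Icc 0 L, dist (f s) (f t) ≤ |s - t|)
    (hloc : ∀ s ∈ Icc 0 L, ∀ t ∈ Icc 0 L, |s - t| < r → dist (f s) (f t) = |s - t|) :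
    ∀ s ∈ Icc 0 L, ∀ t ∈ Icc 0 L, dist (f s) (f t) = |s - t| := by
  have hsub : ∀ t ∈ Icc 0 L, dist (f 0) (f t) = t →
      ∀ s ∈ Icc 0 t, ∀ u ∈ Icc 0 t, s ≤ u → dist (f s) (f u) = u - s := by
    intro t ht h s hs u hu hsu
    have h0 : (0 : ℝ) ∈ Icc 0 L := ⟨le_rfl, ht.1.trans ht.2⟩
    have hs' : s ∈ Icc 0 L := ⟨hs.1, hs.2.trans ht.2⟩
    have hu' : u ∈ Icc 0 L := ⟨hu.1, hu.2.trans ht.2⟩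
    have h₁ := hlip 0 h0 s hs'
    have h₂ := hlip s hs' u hu'
    have h₃ := hlip u hu' t ht
    rw [abs_sub_comm, abs_of_nonneg (by linarith [hs.1])] at h₁
    rw [abs_sub_comm, abs_of_nonneg (by linarith)] at h₂
    rw [abs_sub_comm, abs_of_nonneg (by linarith [hu.2])] at h₃
    have := dist_triangle4 (f 0) (f s) (f u) (f t)
    linarith
  have hind : ∀ n : ℕ, ∀ t ∈ Icc 0 L, t ≤ n * (r / 4) → dist (f 0) (f t) = t := by
    intro n
    induction n with
    | zero =>
      intro t ht htn
      have : t = 0 := le_antisymm (by simpa using htn) ht.1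
      simp [this]
    | succ n ih =>
      intro t ht htn
      have h0 : (0 : ℝ) ∈ Icc 0 L := ⟨le_rfl, ht.1.trans ht.2⟩
      push_cast at htn
      rcases le_or_gt t (r / 4) with htr | htr
      · rw [hloc 0 h0 t ht (by rw [abs_lt]; constructor <;> linarith [ht.1]), zero_sub, abs_neg,
          abs_of_nonneg ht.1]
      set t₀ := t - r / 4 with ht₀
      have ht₀0 : 0 < t₀ := by linarith
      have ht₀L : t₀ ∈ Icc 0 L := ⟨ht₀0.le, by linarith [ht.2]⟩
      have hP := ih t₀ ht₀L (by linarith)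
      have hupper := hlip 0 h0 t ht
      rw [zero_sub, abs_neg, abs_of_nonneg ht.1] at hupper
      refine le_antisymm hupper ?_
      have hback : ∀ s ∈ Icc 0 t₀, ∀ u ∈ Icc 0 t₀,
          dist (f (t₀ - s)) (f (t₀ - u)) = |s - u| := by
        intro s hs u hu
        have hs' : t₀ - s ∈ Icc 0 t₀ := ⟨by linarith [hs.2], by linarith [hs.1]⟩
        have hu' : t₀ - u ∈ Icc 0 t₀ := ⟨by linarith [hu.2], by linarith [hu.1]⟩
        rcases le_total s u with h | h
        · rw [dist_comm, hsub t₀ ht₀L hP _ hu' _ hs' (by linarith), abs_sub_comm,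
            abs_of_nonneg (by linarith)]
          ring
        · rw [hsub t₀ ht₀L hP _ hs' _ hu' (by linarith), abs_of_nonneg (by linarith)]
          ring
      have hforw : ∀ s ∈ Icc 0 (r / 4), ∀ u ∈ Icc 0 (r / 4),
          dist (f (t₀ + s)) (f (t₀ + u)) = |s - u| := by
        intro s hs u hu
        have e : t₀ + s - (t₀ + u) = s - u := by ring
        rw [hloc _ ⟨by linarith [hs.1], by linarith [hs.2, ht.2]⟩ _
          ⟨by linarith [hu.1], by linarith [hu.2, ht.2]⟩, e]
        rw [e, abs_lt]
        constructor <;> linarith [hs.1, hs.2, hu.1, hu.2]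
      have hs₁ : 0 < min t₀ (r / 4) := lt_min ht₀0 (by linarith)
      set s := min t₀ (r / 4) with hs
      have hst : s ≤ t₀ := min_le_left _ _
      have hsr : s ≤ r / 4 := min_le_right _ _
      have et : t₀ + r / 4 = t := by rw [ht₀]; ring
      have hcmp := hX.dist_le_modelDistFromVertex ht₀0.le (by linarith : 0 ≤ r / 4) hback hforw
        (by simp) (fun h => by
          have := hκ h
          rw [sub_self, et, mul_div_assoc]
          linarith [ht.2]) (s := s) (t := s) ⟨hs₁.le, hst⟩ ⟨hs₁.le, hsr⟩
      have hd : dist (f (t₀ - s)) (f (t₀ + s)) = 2 * s := by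
        have e : t₀ - s - (t₀ + s) = -(2 * s) := by ring
        rw [hloc _ ⟨by linarith, by linarith [ht.2]⟩ _ ⟨by linarith, by linarith [ht.2]⟩, e,
          abs_neg, abs_of_nonneg (by linarith)]
        rw [e, abs_neg, abs_of_nonneg (by linarith)]
        linarith
      rw [hd, sub_self, et] at hcmp
      have := add_le_of_two_mul_le_modelDistFromVertex hs₁ hst hsr dist_nonneg
        (fun h => by linarith [hκ h, ht.2]) hcmp
      linarith
  have hall : ∀ t ∈ Icc 0 L, dist (f 0) (f t) = t := by
    intro t ht
    obtain ⟨n, hn⟩ := exists_nat_gt (t / (r / 4))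
    rw [div_lt_iff₀ (by linarith)] at hn
    exact hind n t ht hn.le
  intro s hs t ht
  rcases le_total s t with h | h
  · rw [hsub t ht (hall t ht) s ⟨hs.1, h⟩ t ⟨ht.1, le_rfl⟩ h, abs_sub_comm,
      abs_of_nonneg (by linarith)]
  · rw [dist_comm, hsub s hs (hall s hs) t ⟨ht.1, h⟩ s ⟨hs.1, le_rfl⟩ h,
      abs_of_nonneg (by linarith)]

/-- In a `CAT(κ)` space of diameter less than `π / (2 √κ)`, geodesics issuing from a fixed point
depend continuously on their other endpoint. -/
theorem IsCATSpace.eventually_dist_lt (hX : IsCATSpace κ X)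
    (hdiam : 0 < κ → ∀ p q : X, dist p q < Real.pi / (2 * Real.sqrt κ)) {c : ℝ → X} {L : ℝ}
    (hL : 0 ≤ L) (hc : ∀ s ∈ Icc 0 L, ∀ t ∈ Icc 0 L, dist (c s) (c t) = |s - t|)
    {ε : ℝ} (hε : 0 < ε) :
    ∀ᶠ q in 𝓝 (c L), ∀ c' : ℝ → X, ∀ L', 0 ≤ L' →
      (∀ s ∈ Icc 0 L', ∀ t ∈ Icc 0 L', dist (c' s) (c' t) = |s - t|) → c' 0 = c 0 → c' L' = q →
      ∀ s ∈ Icc 0 L', dist (c' s) (c (min s L)) < ε := by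
  have hcL : dist (c 0) (c L) = L := by
    rw [hc 0 ⟨le_rfl, hL⟩ L ⟨hL, le_rfl⟩, zero_sub, abs_neg, abs_of_nonneg hL]
  have hmodel : ∀ᶠ q in 𝓝 (c L), 0 < L → ∀ s ∈ Icc 0 L, modelDistFromVertex κ s s
      (modelAngle κ L (dist (c 0) q) (dist (c L) q)) < ε / 2 := by
    rcases hL.eq_or_lt with rfl | hL0
    · simp
    have hκL : 0 < κ → L < Real.pi / Real.sqrt κ := fun h => by
      have h' := hdiam h (c 0) (c L)
      have hk : 0 < Real.sqrt κ := Real.sqrt_pos.2 h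
      rw [hcL] at h'
      refine h'.trans_le ?_
      gcongr
      linarith
    simp only [hL0, forall_const]
    refine isCompact_Icc.eventually_forall_of_forall_eventually fun s _ => ?_
    have h₁ : Tendsto (fun z : X × ℝ => dist (c 0) z.1) (𝓝 (c L, s)) (𝓝 L) := by
      have h : Continuous fun z : X × ℝ => dist (c 0) z.1 := by fun_prop
      have h' := h.tendsto (c L, s)
      simpa only [hcL] using h'
    have h₂ : Tendsto (fun z : X × ℝ => dist (c L) z.1) (𝓝 (c L, s)) (𝓝 0) := by
      have h : Continuous fun z : X × ℝ => dist (c L) z.1 := by fun_prop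
      have h' := h.tendsto (c L, s)
      simpa only [dist_self] using h'
    exact (tendsto_modelDistFromVertex_self_zero κ s (continuous_snd.tendsto (c L, s))
      (tendsto_modelAngle_self_zero hL0 hκL h₁ h₂)).eventually (gt_mem_nhds (half_pos hε))
  filter_upwards [hmodel, ball_mem_nhds (c L) (half_pos hε)] with q hq hqε
  intro c' L' hL' hc' h0 hqL s hs
  have hqd : dist q (c L) < ε / 2 := hqε
  have hL'q : dist (c 0) q = L' := by
    rw [← h0, ← hqL, hc' 0 ⟨le_rfl, hL'⟩ L' ⟨hL', le_rfl⟩, zero_sub, abs_neg, abs_of_nonneg hL']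
  have hm : dist (c' (min s L)) (c (min s L)) < ε / 2 := by
    rcases hL.eq_or_lt with rfl | hL0
    · rw [min_eq_right hs.1, h0, dist_self]
      linarith
    have hmL : min s L ∈ Icc 0 L := ⟨le_min hs.1 hL, min_le_right _ _⟩
    have h := hX.dist_le_modelDistFromVertex hL hL' hc hc' h0.symm (fun h => by
      have d₁ := hdiam h (c 0) (c L)
      have d₂ := hdiam h (c 0) q
      have d₃ := hdiam h (c L) q
      have hk : 0 < Real.sqrt κ := Real.sqrt_pos.2 h
      rw [hcL] at d₁
      rw [hL'q] at d₂
      rw [hqL]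
      have e : 2 * Real.pi / Real.sqrt κ = 4 * (Real.pi / (2 * Real.sqrt κ)) := by
        field_simp; norm_num
      rw [e]
      have : 0 < Real.pi / (2 * Real.sqrt κ) := by positivity
      linarith) hmL (t := min s L) ⟨hmL.1, (min_le_left _ _).trans hs.2⟩
    have hq' := hq hL0 _ hmL
    rw [hL'q] at hq'
    rw [hqL] at h
    rw [dist_comm]
    linarith
  have hL'L : L' - L < ε / 2 := by
    have := dist_triangle (c 0) (c L) q
    rw [dist_comm (c L)] at this
    linarith
  have hsm : dist (c' s) (c' (min s L)) < ε / 2 := by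
    rw [hc' s hs _ ⟨le_min hs.1 hL, (min_le_left _ _).trans hs.2⟩]
    rcases le_total s L with h | h
    · rw [min_eq_left h, sub_self, abs_zero]
      linarith
    · rw [min_eq_right h, abs_of_nonneg (by linarith)]
      linarith [hs.2]
  linarith [dist_triangle (c' s) (c' (min s L)) (c (min s L))]

end CATSpace

theorem GeodesicIn.dist_toFun_add {X : Type*} [MetricSpace X] (γ : GeodesicIn X) :
    ∀ s ∈ Icc 0 (γ.b - γ.a), ∀ t ∈ Icc 0 (γ.b - γ.a),
      dist (γ.toFun (γ.a + s)) (γ.toFun (γ.a + t)) = |s - t| := by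
  intro s hs t ht
  rw [γ.isom _ ⟨by linarith [hs.1], by linarith [hs.2]⟩ _
    ⟨by linarith [ht.1], by linarith [ht.2]⟩]
  congr 1; ring

/-- A geodesic of the cover missing the branch locus deforms, with its initial point fixed, to
geodesics with the same property ending at any point close to its final point. -/
theorem IsSimpleBranchedCover.eventually_exists_geodesic {X Y : Type*} [MetricSpace X]
    [MetricSpace Y] {κ : ℝ} {Δ : Set X} {π : Y → X} (hπ : IsSimpleBranchedCover π Δ)
    (hΔ : IsClosed Δ) (hX : IsCATSpace κ X)
    (hdiam : 0 < κ → ∀ p q : X, dist p q < Real.pi / (2 * Real.sqrt κ)) {g : ℝ → Y} {L : ℝ}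
    (hL : 0 ≤ L) (hκL : 0 < κ → L < Real.pi / Real.sqrt κ)
    (hg : ∀ s ∈ Icc 0 L, ∀ t ∈ Icc 0 L, dist (g s) (g t) = |s - t|)
    (hgΔ : ∀ s ∈ Icc 0 L, π (g s) ∉ Δ) :
    ∀ᶠ z in 𝓝 (g L), ∃ γ : GeodesicIn Y, γ.initial = g 0 ∧ γ.final = z ∧
      ∀ t ∈ Icc γ.a γ.b, π (γ.toFun t) ∉ Δ := by
  have hlip := hπ.dist_map_le hΔ
  have hcont : Continuous π := (LipschitzWith.mk_one hlip).continuous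
  have hgcont : ContinuousOn g (Icc 0 L) := Metric.continuousOn_iff.2 fun t ht ε hε =>
    ⟨ε, hε, fun s hs hst => by rwa [hg s hs t ht]⟩
  obtain ⟨r, hr, hball⟩ := hπ.exists_isIsometricBall_of_isCompact hΔ
    (isCompact_Icc.image_of_continuousOn hgcont) (forall_mem_image.2 hgΔ)
  rw [forall_mem_image] at hball
  have hf : ∀ s ∈ Icc 0 L, ∀ t ∈ Icc 0 L, dist (π (g s)) (π (g t)) = |s - t| :=
    hX.dist_eq_of_local (f := fun s => π (g s)) hr hκL
      (fun s hs t ht => (hlip _ _).trans (hg s hs t ht).le) fun s hs t ht hst => by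
        rw [(hball hs).dist_eq _ _ (by simpa using hr) (by rwa [dist_comm, hg s hs t ht]),
          hg s hs t ht]
  have hr4 : 0 < r / 4 := by linarith
  filter_upwards [hcont.continuousAt.eventually
    (hX.eventually_dist_lt (c := fun s => π (g s)) hdiam hL hf hr4),
    ball_mem_nhds (g L) hr4] with z hz hzr
  have hzr' : dist z (g L) < r / 4 := hzr
  obtain ⟨c, hc₁, hc₂⟩ := hX.1 (π (g 0)) (π z)
  have hc := c.dist_toFun_add
  have hL' : 0 ≤ c.b - c.a := sub_nonneg.2 c.hab
  have hc0 : c.toFun (c.a + 0) = π (g 0) := by rw [add_zero]; exact hc₁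
  have hcL : c.toFun (c.a + (c.b - c.a)) = π z := by rw [add_sub_cancel]; exact hc₂
  have hclose := hz (fun s => c.toFun (c.a + s)) (c.b - c.a) hL' hc hc0 hcL
  set L' := c.b - c.a
  have hmin : ∀ s ∈ Icc 0 L', min s L ∈ Icc 0 L := fun s hs =>
    ⟨le_min hs.1 hL, min_le_right _ _⟩
  have hlift : ∀ s, ∃ v, s ∈ Icc 0 L' → dist v (g (min s L)) < r / 4 ∧
      π v = c.toFun (c.a + s) := by
    intro s
    by_cases hs : s ∈ Icc 0 L'
    · obtain ⟨v, hv⟩ := ((hball (hmin s hs)).of_dist_add_le (r' := r / 4)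
        (by rw [dist_self]; linarith) hr4).surj _ (hclose s hs)
      exact ⟨v, fun _ => hv⟩
    · exact ⟨z, fun h => absurd h hs⟩
  choose d hd using hlift
  have hπd : ∀ s ∈ Icc 0 L', ∀ t ∈ Icc 0 L', dist (π (d s)) (π (d t)) = |s - t| := by
    intro s hs t ht
    rw [(hd s hs).2, (hd t ht).2, hc s hs t ht]
  have hloc : ∀ s ∈ Icc 0 L', ∀ t ∈ Icc 0 L', |s - t| < r / 4 → dist (d s) (d t) = |s - t| := by
    intro s hs t ht hst
    have h₁ := (hd s hs).1
    have h₂ := (hd t ht).1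
    have h₃ : dist (g (min t L)) (g (min s L)) ≤ |s - t| := by
      rw [hg _ (hmin t ht) _ (hmin s hs), abs_sub_comm s t]
      simpa using abs_min_sub_min_le_max t L s L
    rw [← (hball (hmin s hs)).dist_eq _ _ (by linarith)
      (by linarith [dist_triangle (d t) (g (min t L)) (g (min s L))]), hπd s hs t ht]
  have hle : ∀ s ∈ Icc 0 L', ∀ t ∈ Icc 0 L', s ≤ t → dist (d s) (d t) ≤ t - s := by
    intro s hs t ht hst
    refine rel_Icc_of_local (R := fun s t => dist (d s) (d t) ≤ t - s) hst ?_ ?_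
    · intro u v w _ _ h₁ h₂
      linarith [dist_triangle (d u) (d v) (d w)]
    · intro u hu
      refine ⟨r / 4, hr4, fun v hv hvu => ?_⟩
      have h := hloc v ⟨hs.1.trans hv.1, hv.2.trans ht.2⟩ u ⟨hs.1.trans hu.1, hu.2.trans ht.2⟩ hvu
      refine ⟨fun hle => ?_, fun hle => ?_⟩
      · rw [h, abs_sub_comm, abs_of_nonneg (by linarith)]
      · rw [dist_comm, h, abs_of_nonneg (by linarith)]
  refine ⟨⟨0, L', hL', d, fun s hs t ht => ?_⟩, ?_, ?_, ?_⟩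
  · refine le_antisymm ?_ ((hπd s hs t ht).symm.le.trans (hlip _ _))
    rcases le_total s t with h | h
    · rw [abs_sub_comm, abs_of_nonneg (by linarith)]
      exact hle s hs t ht h
    · rw [dist_comm, abs_of_nonneg (by linarith)]
      exact hle t ht s hs h
  · show d 0 = g 0
    have h0 : (0 : ℝ) ∈ Icc 0 L' := ⟨le_rfl, hL'⟩
    have h := hd 0 h0
    rw [min_eq_left hL] at h
    rw [← dist_eq_zero, ← (hball (left_mem_Icc.2 hL)).dist_eq _ _ (by linarith) (by simpa using hr),
      h.2, hc0, dist_self]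
  · show d L' = z
    have h1 : L' ∈ Icc 0 L' := ⟨hL', le_rfl⟩
    have h := hd L' h1
    have hLL' : L - L' ≤ dist z (g L) := by
      have e₁ := hf 0 (left_mem_Icc.2 hL) L (right_mem_Icc.2 hL)
      have e₂ := hc 0 (left_mem_Icc.2 hL') L' h1
      rw [hc0, hcL, zero_sub, abs_neg, abs_of_nonneg hL'] at e₂
      rw [zero_sub, abs_neg, abs_of_nonneg hL] at e₁
      linarith [dist_triangle (π (g 0)) (π z) (π (g L)), hlip z (g L)]
    have hz' : dist z (g (min L' L)) < r := by
      have e := hg L (right_mem_Icc.2 hL) _ (hmin L' h1)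
      have : |L - min L' L| < r / 4 := by
        rw [abs_of_nonneg (sub_nonneg.2 (min_le_right _ _))]
        rcases le_total L' L with h | h
        · rw [min_eq_left h]; linarith
        · rw [min_eq_right h]; linarith
      linarith [dist_triangle z (g L) (g (min L' L))]
    rw [← dist_eq_zero, ← (hball (hmin L' h1)).dist_eq _ _ (by linarith) hz', h.2, hcL, dist_self]
  · intro s hs
    exact (hball (hmin s hs)).notMem _ (by linarith [(hd s hs).1])

theorem dist_lt_of_ediam_lt {X : Type*} [MetricSpace X] {D : ℝ}
    (h : Metric.ediam (Set.univ : Set X) < ENNReal.ofReal D) (p q : X) : dist p q < D := by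
  have hlt := (Metric.edist_le_ediam_of_mem (mem_univ p) (mem_univ q)).trans_lt h
  rw [edist_dist] at hlt
  exact (ENNReal.ofReal_lt_ofReal_iff_of_nonneg dist_nonneg).1 hlt

/-- Lemma 3.2(v): for a point  of the cover not over Δ, the set of points joined to 
by a geodesic missing Δ is open. -/
theorem stmt_6 {X Y : Type*} [MetricSpace X] [MetricSpace Y] (κ : ℝ)
    (Δ : Set X) (hΔclosed : IsClosed Δ) (hΔconvex : IsConvexSubset Δ)
    (hX : IsCATSpace κ X) (π : Y → X) (hπ : IsSimpleBranchedCover π Δ)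
    (hdiam : 0 < κ →
      EMetric.diam (Set.univ : Set X) < ENNReal.ofReal (Real.pi / (2 * Real.sqrt κ)) ∧
      EMetric.diam (Set.univ : Set Y) < ENNReal.ofReal (2 * Real.pi / (3 * Real.sqrt κ)))
    (x : Y) (hx : π x ∉ Δ) :
    IsOpen {z : Y | ∃ γ : GeodesicIn Y, γ.initial = x ∧ γ.final = z ∧
      ∀ t ∈ Set.Icc γ.a γ.b, π (γ.toFun t) ∉ Δ} := by
  rw [isOpen_iff_mem_nhds]
  rintro z ⟨γ, hγx, hγz, hγΔ⟩
  have hL : 0 ≤ γ.b - γ.a := sub_nonneg.2 γ.hab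
  have hg := γ.dist_toFun_add
  have hg0 : γ.toFun (γ.a + 0) = x := by rw [add_zero]; exact hγx
  have hgL : γ.toFun (γ.a + (γ.b - γ.a)) = z := by rw [add_sub_cancel]; exact hγz
  have hκL : 0 < κ → γ.b - γ.a < Real.pi / Real.sqrt κ := by
    intro hκ
    have h := dist_lt_of_ediam_lt (hdiam hκ).2 x z
    have hk : 0 < Real.sqrt κ := Real.sqrt_pos.2 hκ
    rw [← hg0, ← hgL, hg 0 ⟨le_rfl, hL⟩ _ ⟨hL, le_rfl⟩, zero_sub, abs_neg, abs_of_nonneg hL] at h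
    have e : 2 * Real.pi / (3 * Real.sqrt κ) = 2 / 3 * (Real.pi / Real.sqrt κ) := by
      field_simp
    have : 0 < Real.pi / Real.sqrt κ := by positivity
    linarith
  have h := hπ.eventually_exists_geodesic hΔclosed hX
    (fun hκ => dist_lt_of_ediam_lt (hdiam hκ).1) (g := fun s => γ.toFun (γ.a + s)) hL hκL hg
    fun s hs => hγΔ _ ⟨by linarith [hs.1], by linarith [hs.2]⟩
  simp only [hg0, hgL] at h
  exact h
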